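/- arXiv:2309.00377 — 3 statements merged into one kernel-verified Lean document; each statement's English description precedes it below -/
import Mathlib

section
/- Let E : H → [0,∞] be convex, lower semicontinuous, not identically +∞, with E(0) = 0, and suppose its subdifferential is positively 1-homogeneous: for every u ∈ H and every λ > 0, ∂E(λu) = {λξ : ξ ∈ ∂E(u)}. Then E is positively 2-homogeneous: E(λu) = λ² E(u) for all λ > 0 and u ∈ H. -/
open scoped ENNReal RealInnerProductSpace

/-- The subdifferential of `E : H → [0,∞]` at `u`: the set of `ξ ∈ H` such that
`E z - E u ≥ ⟪ξ, z - u⟫` for all `z` (empty outside the domain `D(E) = {E ≠ ∞}`). -/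
def subdiff {H : Type*} [NormedAddCommGroup H] [InnerProductSpace ℝ H]
    (E : H → ℝ≥0∞) (u : H) : Set H :=
  {ξ | E u ≠ ⊤ ∧ ∀ z : H, E z ≠ ⊤ → ⟪ξ, z - u⟫ ≤ (E z).toReal - (E u).toReal}

open Filter Topology

section Helpers

variable {H : Type*} [NormedAddCommGroup H] [InnerProductSpace ℝ H]

/-- If `a` is a selection of subgradients of both `g` and `h`, then `h - g` is maximal at `0`
(hence constant). -/
theorem sub_le_sub_of_common_subgradient (g h : H → ℝ) (a : H → H)
    (hg : ∀ x y, ⟪a x, y - x⟫ ≤ g y - g x) (hh : ∀ x y, ⟪a x, y - x⟫ ≤ h y - h x) (x : H) :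
    h x - g x ≤ h 0 - g 0 := by
  have step : ∀ (δ : ℝ) (k : ℕ), h ((k * δ) • x) - g ((k * δ) • x) - (h 0 - g 0) ≤
      δ * ⟪a ((k * δ) • x) - a 0, x⟫ := by
    intro δ k
    induction k with
    | zero => simp
    | succ k ih =>
      have h1 := hg ((k * δ) • x) (((k + 1 : ℕ) * δ) • x)
      have h2 := hh (((k + 1 : ℕ) * δ) • x) ((k * δ) • x)
      rw [← sub_smul, inner_smul_right] at h1 h2
      push_cast at h1 h2 ⊢
      rw [inner_sub_left] at ih ⊢
      linarith
  have bound : ∀ n : ℕ, h x - g x - (h 0 - g 0) ≤ 1 / ((n : ℝ) + 1) * ⟪a x - a 0, x⟫ := by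
    intro n
    have := step (1 / ((n : ℝ) + 1)) (n + 1)
    have e : ((n + 1 : ℕ) : ℝ) * (1 / ((n : ℝ) + 1)) = 1 := by
      push_cast
      field_simp
    rwa [e, one_smul] at this
  have lim := (tendsto_one_div_add_atTop_nhds_zero_nat (𝕜 := ℝ)).mul_const ⟪a x - a 0, x⟫
  rw [zero_mul] at lim
  linarith [ge_of_tendsto' lim bound]

/-- Convexity of `E`, read in `ℝ` on the domain of `E`. -/
theorem toReal_convex_comb_le {E : H → ℝ≥0∞}
    (hconv : ∀ u v : H, ∀ t : ℝ, t ∈ Set.Icc (0 : ℝ) 1 →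
      E (t • u + (1 - t) • v) ≤ ENNReal.ofReal t * E u + ENNReal.ofReal (1 - t) * E v)
    {u v : H} (hu : E u ≠ ⊤) (hv : E v ≠ ⊤) {t : ℝ} (ht : t ∈ Set.Icc (0 : ℝ) 1) :
    E (t • u + (1 - t) • v) ≠ ⊤ ∧
      (E (t • u + (1 - t) • v)).toReal ≤ t * (E u).toReal + (1 - t) * (E v).toReal := by
  have h := hconv u v t ht
  have h1 : ENNReal.ofReal t * E u ≠ ⊤ := ENNReal.mul_ne_top ENNReal.ofReal_ne_top hu
  have h2 : ENNReal.ofReal (1 - t) * E v ≠ ⊤ := ENNReal.mul_ne_top ENNReal.ofReal_ne_top hv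
  refine ⟨ne_top_of_le_ne_top (ENNReal.add_ne_top.2 ⟨h1, h2⟩) h, ?_⟩
  have := ENNReal.toReal_mono (ENNReal.add_ne_top.2 ⟨h1, h2⟩) h
  rwa [ENNReal.toReal_add h1 h2, ENNReal.toReal_mul, ENNReal.toReal_mul,
    ENNReal.toReal_ofReal ht.1, ENNReal.toReal_ofReal (sub_nonneg.2 ht.2)] at this

/-- A minimizer of `E + c / 2 * ‖· - x‖ ^ 2` exists. -/
theorem exists_prox_minimizer [CompleteSpace H] {E : H → ℝ≥0∞}
    (hconv : ∀ u v : H, ∀ t : ℝ, t ∈ Set.Icc (0 : ℝ) 1 →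
      E (t • u + (1 - t) • v) ≤ ENNReal.ofReal t * E u + ENNReal.ofReal (1 - t) * E v)
    (hlsc : LowerSemicontinuous E) (hne : ∃ u : H, E u ≠ ⊤) (x : H) {c : ℝ} (hc : 0 < c) :
    ∃ p : H, E p ≠ ⊤ ∧ ∀ z, E z ≠ ⊤ →
      (E p).toReal + c / 2 * ‖p - x‖ ^ 2 ≤ (E z).toReal + c / 2 * ‖z - x‖ ^ 2 := by
  set q : H → ℝ := fun z => c / 2 * ‖z - x‖ ^ 2 with hq
  have hq0 : ∀ z, 0 ≤ q z := fun z => by positivity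
  have hqc : Continuous q := by fun_prop
  set Φ : H → ℝ≥0∞ := fun z => E z + ENNReal.ofReal (q z) with hΦ
  have hΦlsc : LowerSemicontinuous Φ :=
    hlsc.add (ENNReal.continuous_ofReal.comp hqc).lowerSemicontinuous
  have hΦtop : ∀ z, E z ≠ ⊤ → Φ z ≠ ⊤ := fun z hz =>
    ENNReal.add_ne_top.2 ⟨hz, ENNReal.ofReal_ne_top⟩
  have hΦreal : ∀ z, E z ≠ ⊤ → (Φ z).toReal = (E z).toReal + q z := fun z hz => by
    rw [hΦ, ENNReal.toReal_add hz ENNReal.ofReal_ne_top, ENNReal.toReal_ofReal (hq0 z)]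
  set m : ℝ≥0∞ := ⨅ z, Φ z with hm
  have hmtop : m ≠ ⊤ := by
    obtain ⟨u, hu⟩ := hne
    exact ne_top_of_le_ne_top (hΦtop u hu) (iInf_le _ u)
  have near : ∀ n : ℕ, ∃ z, Φ z ≤ m + ENNReal.ofReal (1 / ((n : ℝ) + 1)) := fun n => by
    have : m < m + ENNReal.ofReal (1 / ((n : ℝ) + 1)) :=
      ENNReal.lt_add_right hmtop (by rw [Ne, ENNReal.ofReal_eq_zero, not_le]; positivity)
    obtain ⟨z, hz⟩ := iInf_lt_iff.1 this
    exact ⟨z, hz.le⟩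
  choose w hw using near
  have close : ∀ (ε : ℝ), 0 ≤ ε → ∀ y z, Φ y ≤ m + ENNReal.ofReal ε →
      Φ z ≤ m + ENNReal.ofReal ε → c / 8 * ‖y - z‖ ^ 2 ≤ ε := by
    intro ε hε y z hy hz
    have hfin : m + ENNReal.ofReal ε ≠ ⊤ := ENNReal.add_ne_top.2 ⟨hmtop, ENNReal.ofReal_ne_top⟩
    have hEy : E y ≠ ⊤ := ne_top_of_le_ne_top hfin (le_self_add.trans hy)
    have hEz : E z ≠ ⊤ := ne_top_of_le_ne_top hfin (le_self_add.trans hz)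
    have hy' := ENNReal.toReal_mono hfin hy
    have hz' := ENNReal.toReal_mono hfin hz
    rw [ENNReal.toReal_add hmtop ENNReal.ofReal_ne_top, ENNReal.toReal_ofReal hε] at hy' hz'
    rw [hΦreal _ hEy] at hy'
    rw [hΦreal _ hEz] at hz'
    obtain ⟨hmid, hmid'⟩ := toReal_convex_comb_le hconv hEy hEz (t := 1 / 2) (by norm_num)
    have hmin := ENNReal.toReal_mono (hΦtop _ hmid) (iInf_le Φ _)
    rw [hΦreal _ hmid] at hmin
    have hpar : q ((1 / 2 : ℝ) • y + (1 - 1 / 2 : ℝ) • z) =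
        q y / 2 + q z / 2 - c / 8 * ‖y - z‖ ^ 2 := by
      have e1 : (1 / 2 : ℝ) • y + (1 - 1 / 2 : ℝ) • z - x
          = (1 / 2 : ℝ) • ((y - x) + (z - x)) := by
        module
      have e2 : y - z = (y - x) - (z - x) := by abel
      simp only [hq]
      rw [e1, e2, norm_smul, mul_pow, norm_add_sq_real, norm_sub_sq_real (y - x)]
      norm_num
      ring
    rw [hpar] at hmin
    linarith
  have hεlim := tendsto_one_div_add_atTop_nhds_zero_nat (𝕜 := ℝ)
  have mono : ∀ {N n : ℕ}, N ≤ n → Φ (w n) ≤ m + ENNReal.ofReal (1 / ((N : ℝ) + 1)) := by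
    intro N n hn
    refine (hw n).trans ?_
    gcongr
  have hcau : CauchySeq w := by
    rw [Metric.cauchySeq_iff]
    intro ε hε
    obtain ⟨N, hN⟩ := (hεlim.eventually (gt_mem_nhds (show 0 < c / 8 * ε ^ 2 by positivity))).exists
    refine ⟨N, fun i hi j hj => ?_⟩
    have := (close _ (by positivity) _ _ (mono hi) (mono hj)).trans_lt hN
    rw [dist_eq_norm]
    exact lt_of_pow_lt_pow_left₀ 2 hε.le (lt_of_mul_lt_mul_left this (by positivity))
  obtain ⟨p, hp⟩ := cauchySeq_tendsto_of_complete hcau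
  have hpN : ∀ N : ℕ, Φ p ≤ m + ENNReal.ofReal (1 / ((N : ℝ) + 1)) := fun N =>
    (hΦlsc.isClosed_preimage _).mem_of_tendsto hp
      ((eventually_ge_atTop N).mono fun n hn => mono hn)
  have hpm : Φ p ≤ m := by
    have lim := (ENNReal.tendsto_ofReal hεlim).const_add m
    rw [ENNReal.ofReal_zero, add_zero] at lim
    exact ge_of_tendsto' lim hpN
  have hEp : E p ≠ ⊤ := ne_top_of_le_ne_top hmtop (le_self_add.trans hpm)
  refine ⟨p, hEp, fun z hz => ?_⟩
  have := ENNReal.toReal_mono (hΦtop z hz) (hpm.trans (iInf_le _ z))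
  rwa [hΦreal _ hEp, hΦreal _ hz] at this

/-- Surjectivity of `id + c⁻¹ ∂E`. -/
theorem exists_smul_sub_mem_subdiff [CompleteSpace H] {E : H → ℝ≥0∞}
    (hconv : ∀ u v : H, ∀ t : ℝ, t ∈ Set.Icc (0 : ℝ) 1 →
      E (t • u + (1 - t) • v) ≤ ENNReal.ofReal t * E u + ENNReal.ofReal (1 - t) * E v)
    (hlsc : LowerSemicontinuous E) (hne : ∃ u : H, E u ≠ ⊤) (x : H) {c : ℝ} (hc : 0 < c) :
    ∃ p : H, c • (x - p) ∈ subdiff E p := by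
  obtain ⟨p, hp, hmin⟩ := exists_prox_minimizer hconv hlsc hne x hc
  refine ⟨p, hp, fun z hz => ?_⟩
  have key : ∀ n : ℕ, ⟪c • (x - p), z - p⟫ - ((E z).toReal - (E p).toReal) ≤
      1 / ((n : ℝ) + 1) * (c / 2 * ‖z - p‖ ^ 2) := by
    intro n
    set t : ℝ := 1 / ((n : ℝ) + 1) with ht
    have ht0 : 0 < t := by positivity
    have ht1 : t ≤ 1 := by
      rw [ht, div_le_one (by positivity)]
      linarith [n.cast_nonneg (α := ℝ)]
    obtain ⟨hfin, hle⟩ := toReal_convex_comb_le hconv hz hp ⟨ht0.le, ht1⟩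
    have h1 := hmin _ hfin
    have e : t • z + (1 - t) • p - x = t • (z - p) - (x - p) := by module
    rw [e, norm_sub_sq_real (t • (z - p)), norm_smul, mul_pow, real_inner_smul_left, Real.norm_eq_abs, sq_abs,
      norm_sub_rev p x] at h1
    rw [real_inner_smul_left, real_inner_comm]
    refine le_of_mul_le_mul_left ?_ ht0
    linarith
  have lim := (tendsto_one_div_add_atTop_nhds_zero_nat (𝕜 := ℝ)).mul_const (c / 2 * ‖z - p‖ ^ 2)
  rw [zero_mul] at lim
  linarith [ge_of_tendsto' lim key]

/-- A subgradient inequality for `E` at the points `J x` gives one for the Moreau envelope. -/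
theorem inner_le_envelope_sub {E : H → ℝ≥0∞} {J : H → H} {c : ℝ} (hc : 0 < c)
    (hJ : ∀ x, c • (x - J x) ∈ subdiff E (J x)) (x y : H) :
    ⟪c • (x - J x), y - x⟫ ≤ ((E (J y)).toReal + c / 2 * ‖y - J y‖ ^ 2) -
      ((E (J x)).toReal + c / 2 * ‖x - J x‖ ^ 2) := by
  have h := (hJ x).2 (J y) (hJ y).1
  have e : J y - J x = (y - x) - ((y - J y) - (x - J x)) := by abel
  have hsq : 0 ≤ c / 2 * ‖(y - J y) - (x - J x)‖ ^ 2 := by positivity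
  rw [norm_sub_sq_real, real_inner_comm] at hsq
  rw [e, inner_sub_right, real_inner_smul_left _ (y - J y - (x - J x)),
    inner_sub_right (x - J x) (y - J y),
    real_inner_self_eq_norm_sq] at h
  linarith

/-- Comparison of functionals through their subdifferentials. -/
theorem le_of_subdiff_subset [CompleteSpace H] {E F : H → ℝ≥0∞}
    (hconv : ∀ u v : H, ∀ t : ℝ, t ∈ Set.Icc (0 : ℝ) 1 →
      E (t • u + (1 - t) • v) ≤ ENNReal.ofReal t * E u + ENNReal.ofReal (1 - t) * E v)
    (hlsc : LowerSemicontinuous E) (hE0 : E 0 = 0) (hFlsc : LowerSemicontinuous F)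
    (hF0 : F 0 = 0) (hsub : ∀ u, subdiff E u ⊆ subdiff F u) (x : H) : F x ≤ E x := by
  by_cases hx : E x = ⊤
  · simp [hx]
  have prox : ∀ c : ℝ, 0 < c → ∃ p, F p ≤ E x ∧ c * ‖x - p‖ ^ 2 ≤ (E x).toReal := by
    intro c hc
    choose J hJ using fun y =>
      exists_smul_sub_mem_subdiff hconv hlsc ⟨0, by simp [hE0]⟩ y hc
    have hJF := fun y => hsub _ (hJ y)
    have hJ0 : J 0 = 0 := by
      have h := (hJ 0).2 0 (by simp [hE0])
      rw [real_inner_smul_left, real_inner_self_eq_norm_sq, hE0, ENNReal.toReal_zero, zero_sub,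
        zero_sub, norm_neg] at h
      have h' : c * ‖J 0‖ ^ 2 ≤ 0 := h.trans (neg_nonpos.2 ENNReal.toReal_nonneg)
      have : ‖J 0‖ ^ 2 ≤ 0 := nonpos_of_mul_nonpos_right h' hc
      simpa using le_antisymm this (sq_nonneg _)
    have h1 := sub_le_sub_of_common_subgradient _ _ (fun y => c • (y - J y))
      (inner_le_envelope_sub hc hJ) (inner_le_envelope_sub hc hJF) x
    simp only [hJ0, hE0, hF0] at h1
    have h2 := (hJ x).2 x hx
    rw [real_inner_smul_left, real_inner_self_eq_norm_sq] at h2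
    have hpos : 0 ≤ c * ‖x - J x‖ ^ 2 := by positivity
    refine ⟨J x, (ENNReal.toReal_le_toReal (hJF x).1 hx).1 (by linarith), ?_⟩
    linarith [ENNReal.toReal_nonneg (a := E (J x))]
  choose p hp using fun n : ℕ => prox ((n : ℝ) + 1) (by positivity)
  have lim : Tendsto p atTop (𝓝 x) := by
    rw [tendsto_iff_norm_sub_tendsto_zero]
    have l0 := (tendsto_one_div_add_atTop_nhds_zero_nat (𝕜 := ℝ)).mul_const (E x).toReal
    rw [zero_mul] at l0
    have l1 : Tendsto (fun n => ‖p n - x‖ ^ 2) atTop (𝓝 0) :=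
      squeeze_zero (fun n => by positivity) (fun n => by
        have hn : (0 : ℝ) < n + 1 := by positivity
        rw [norm_sub_rev, one_div, ← div_eq_inv_mul, le_div_iff₀ hn, mul_comm]
        exact (hp n).2) l0
    simpa using l1.sqrt
  exact (hFlsc.isClosed_preimage (E x)).mem_of_tendsto lim (Eventually.of_forall fun n => (hp n).1)

end Helpers

/-- if `E` is convex, lower semicontinuous, not identically `+∞`, `E 0 = 0`,
and its subdifferential is positively `1`-homogeneous (`∂E(λu) = λ • ∂E(u)` for `λ > 0`),
then `E` is positively `2`-homogeneous. -/
theorem stmt2 {H : Type*} [NormedAddCommGroup H] [InnerProductSpace ℝ H] [CompleteSpace H]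
    (E : H → ℝ≥0∞)
    (hconv : ∀ u v : H, ∀ t : ℝ, t ∈ Set.Icc (0 : ℝ) 1 →
      E (t • u + (1 - t) • v) ≤ ENNReal.ofReal t * E u + ENNReal.ofReal (1 - t) * E v)
    (hlsc : LowerSemicontinuous E)
    (hne : ∃ u : H, E u ≠ ⊤)
    (h0 : E 0 = 0)
    (hsub : ∀ (u : H) (l : ℝ), 0 < l → subdiff E (l • u) = (fun ξ => l • ξ) '' subdiff E u) :
    ∀ (l : ℝ), 0 < l → ∀ u : H, E (l • u) = ENNReal.ofReal (l ^ 2) * E u := by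
  have key : ∀ (l : ℝ), 0 < l → ∀ u : H,
      ENNReal.ofReal (l⁻¹ ^ 2) * E (l • u) ≤ E u := by
    intro l hl u
    have hl2 : 0 < l⁻¹ ^ 2 := by positivity
    refine le_of_subdiff_subset (F := fun u => ENNReal.ofReal (l⁻¹ ^ 2) * E (l • u))
      hconv hlsc h0 ?_ (by simp [h0]) ?_ u
    · exact (ENNReal.continuous_const_mul ENNReal.ofReal_ne_top).comp_lowerSemicontinuous
        (hlsc.comp (continuous_const_smul l)) (fun _ _ h => mul_le_mul_right h _)
    · intro v ξ hξ
      have hmem : l • ξ ∈ subdiff E (l • v) := by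
        rw [hsub v l hl]
        exact ⟨ξ, hξ, rfl⟩
      refine ⟨ENNReal.mul_ne_top ENNReal.ofReal_ne_top hmem.1, fun z hz => ?_⟩
      have hz' : E (l • z) ≠ ⊤ := fun h => hz (by
        simp only [h]
        exact ENNReal.mul_top (by simpa using hl.ne'))
      have h := hmem.2 _ hz'
      rw [← smul_sub, real_inner_smul_left, real_inner_smul_right] at h
      simp only [ENNReal.toReal_mul, ENNReal.toReal_ofReal hl2.le]
      calc ⟪ξ, z - v⟫ = l⁻¹ ^ 2 * (l * (l * ⟪ξ, z - v⟫)) := by field_simp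
        _ ≤ l⁻¹ ^ 2 * ((E (l • z)).toReal - (E (l • v)).toReal) := by gcongr
        _ = _ := by ring
  intro l hl u
  apply le_antisymm
  · calc E (l • u) = ENNReal.ofReal (l ^ 2) * (ENNReal.ofReal (l⁻¹ ^ 2) * E (l • u)) := by
          rw [← mul_assoc, ← ENNReal.ofReal_mul (by positivity), ← mul_pow,
            mul_inv_cancel₀ hl.ne', one_pow, ENNReal.ofReal_one, one_mul]
      _ ≤ _ := by gcongr; exact key l hl u
  · have h := key l⁻¹ (inv_pos.2 hl) (l • u)
    rwa [inv_inv, smul_smul, inv_mul_cancel₀ hl.ne', one_smul] at h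
end

section
/- Let E : H → [0,∞] be convex and 2-homogeneous. Suppose E is regular, i.e. Λ⁺(u,v) = Λ⁻(u,v) =: Λ(u,v) for all u, v ∈ D(E), and that Λ is symmetric: Λ(u,v) = Λ(v,u) for all u, v ∈ D(E). Then E satisfies the parallelogram identity on D(E): E(u + v) + E(u − v) = 2 E(u) + 2 E(v) for all u, v ∈ D(E); hence E is a quadratic form on D(E). -/
open scoped ENNReal

/-- The right slope `Λ⁺(u,v) = lim_{σ→0⁺} (E(u+σv) − E(u))/σ`, which for a convex
`2`-homogeneous `E` and `u, v ∈ D(E)` equals `inf_{σ>0} (E(u+σv) − E(u))/σ`. -/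
noncomputable def slopeP {H : Type*} [AddCommGroup H] [Module ℝ H]
    (E : H → ℝ≥0∞) (u v : H) : ℝ :=
  sInf {r : ℝ | ∃ σ : ℝ, 0 < σ ∧ r = ((E (u + σ • v)).toReal - (E u).toReal) / σ}

/-- The left slope `Λ⁻(u,v) = lim_{σ→0⁻} (E(u+σv) − E(u))/σ`, which for a convex
`2`-homogeneous `E` and `u, v ∈ D(E)` equals `sup_{σ<0} (E(u+σv) − E(u))/σ`. -/
noncomputable def slopeM {H : Type*} [AddCommGroup H] [Module ℝ H]
    (E : H → ℝ≥0∞) (u v : H) : ℝ :=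
  sSup {r : ℝ | ∃ σ : ℝ, σ < 0 ∧ r = ((E (u + σ • v)).toReal - (E u).toReal) / σ}

section Slopes

variable {H : Type*} [AddCommGroup H] [Module ℝ H] {E : H → ℝ≥0∞}

/-- The domain of a convex `2`-homogeneous functional is closed under `u + σ • v`. -/
lemma ne_top_add_smul
    (hconv : ∀ u v : H, ∀ t : ℝ, t ∈ Set.Icc (0 : ℝ) 1 →
      E (t • u + (1 - t) • v) ≤ ENNReal.ofReal t * E u + ENNReal.ofReal (1 - t) * E v)
    (hhom : ∀ (ν : ℝ) (u : H), E (ν • u) = ENNReal.ofReal (ν ^ 2) * E u)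
    {u v : H} (hu : E u ≠ ⊤) (hv : E v ≠ ⊤) (σ : ℝ) : E (u + σ • v) ≠ ⊤ := by
  have h := hconv ((2 : ℝ) • u) ((2 * σ) • v) (1 / 2) (by norm_num)
  have hsum : (1 / 2 : ℝ) • (2 : ℝ) • u + (1 - 1 / 2 : ℝ) • (2 * σ) • v = u + σ • v := by
    module
  rw [hsum, hhom, hhom] at h
  exact ne_top_of_le_ne_top (by finiteness) h

/-- A convex `2`-homogeneous functional restricts to a real convex function on lines in its
domain. -/
lemma convexOn_toReal_add_smul
    (hconv : ∀ u v : H, ∀ t : ℝ, t ∈ Set.Icc (0 : ℝ) 1 →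
      E (t • u + (1 - t) • v) ≤ ENNReal.ofReal t * E u + ENNReal.ofReal (1 - t) * E v)
    (hhom : ∀ (ν : ℝ) (u : H), E (ν • u) = ENNReal.ofReal (ν ^ 2) * E u)
    {u v : H} (hu : E u ≠ ⊤) (hv : E v ≠ ⊤) :
    ConvexOn ℝ Set.univ fun σ : ℝ => (E (u + σ • v)).toReal := by
  refine ⟨convex_univ, fun x _ y _ a b ha hb hab => ?_⟩
  obtain rfl : b = 1 - a := by linarith
  have hx := ne_top_add_smul hconv hhom hu hv x
  have hy := ne_top_add_smul hconv hhom hu hv y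
  have h := hconv (u + x • v) (u + y • v) a ⟨ha, by linarith⟩
  have hcomb : a • (u + x • v) + (1 - a) • (u + y • v) = u + (a • x + (1 - a) • y) • v := by
    simp only [smul_eq_mul]
    module
  rw [hcomb] at h
  have hreal := ENNReal.toReal_mono (by finiteness) h
  rwa [ENNReal.toReal_add (by finiteness) (by finiteness), ENNReal.toReal_mul,
    ENNReal.toReal_mul, ENNReal.toReal_ofReal ha, ENNReal.toReal_ofReal hb] at hreal

/-- Where the one-sided slopes agree, `slopeP` is the directional derivative. -/
lemma hasDerivAt_slopeP {u v : H}
    (hf : ConvexOn ℝ Set.univ fun σ : ℝ => (E (u + σ • v)).toReal)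
    (hreg : slopeP E u v = slopeM E u v) :
    HasDerivAt (fun σ : ℝ => (E (u + σ • v)).toReal) (slopeP E u v) 0 := by
  have hR := hf.hasDerivWithinAt_sInf_slope_of_mem_interior (x := 0) (by simp)
  have hL := hf.hasDerivWithinAt_sSup_slope_of_mem_interior (x := 0) (by simp)
  rw [hasDerivWithinAt_iff_tendsto_slope' (by simp)] at hR hL
  rw [hasDerivAt_iff_tendsto_slope_left_right]
  constructor
  · rw [hreg]
    convert hL using 2
    unfold slopeM
    congr 1
    ext r
    simp [slope_def_field, eq_comm]
  · convert hR using 2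
    unfold slopeP
    congr 1
    ext r
    simp [slope_def_field, eq_comm]

/-- Directional derivatives of a `2`-homogeneous functional along `u + s • v` at `v`. -/
lemma hasDerivAt_toReal_add_smul_add_smul
    (hhom : ∀ (ν : ℝ) (u : H), E (ν • u) = ENNReal.ofReal (ν ^ 2) * E u)
    {u v : H} {L : ℝ} (h : HasDerivAt (fun σ : ℝ => (E (v + σ • u)).toReal) L 0) (s : ℝ) :
    HasDerivAt (fun τ : ℝ => (E (v + τ • (u + s • v))).toReal)
      (L + 2 * s * (E v).toReal) 0 := by
  have hlin : HasDerivAt (fun τ : ℝ => 1 + τ * s) s 0 := by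
    simpa using ((hasDerivAt_id (0 : ℝ)).mul_const s).const_add 1
  have hquot : HasDerivAt (fun τ : ℝ => τ / (1 + τ * s)) 1 0 := by
    simpa using (hasDerivAt_id (0 : ℝ)).fun_div hlin (by simp)
  have hcomp : HasDerivAt (fun τ : ℝ => (E (v + (τ / (1 + τ * s)) • u)).toReal) (L * 1) 0 :=
    HasDerivAt.comp (h₂ := fun σ : ℝ => (E (v + σ • u)).toReal) 0 (by simpa using h) hquot
  have hprod := (hlin.fun_pow 2).fun_mul hcomp
  have hne : ∀ᶠ τ : ℝ in nhds 0, 1 + τ * s ≠ 0 :=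
    hlin.continuousAt.eventually_ne (by simp)
  refine (hprod.congr_of_eventuallyEq ?_).congr_deriv ?_
  · filter_upwards [hne] with τ hτ
    have hfac : v + τ • (u + s • v) = (1 + τ * s) • (v + (τ / (1 + τ * s)) • u) := by
      rw [smul_add (1 + τ * s), smul_smul, mul_div_cancel₀ _ hτ]
      module
    rw [hfac, hhom, ENNReal.toReal_mul, ENNReal.toReal_ofReal (sq_nonneg _)]
  · simp
    ring

end Slopes

/-- if `E` is convex, `2`-homogeneous, regular (i.e.
`Λ⁺(u,v) = Λ⁻(u,v) =: Λ(u,v)` for all `u, v ∈ D(E)`) and `Λ` is symmetric on `D(E)`,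
then `E` satisfies the parallelogram identity on `D(E)`:
`E(u+v) + E(u−v) = 2 E(u) + 2 E(v)`; hence `E` is a quadratic form on `D(E)`. -/
theorem stmt15 {H : Type*} [NormedAddCommGroup H] [InnerProductSpace ℝ H] [CompleteSpace H]
    (E : H → ℝ≥0∞)
    (hconv : ∀ u v : H, ∀ t : ℝ, t ∈ Set.Icc (0 : ℝ) 1 →
      E (t • u + (1 - t) • v) ≤ ENNReal.ofReal t * E u + ENNReal.ofReal (1 - t) * E v)
    (hhom : ∀ (ν : ℝ) (u : H), E (ν • u) = ENNReal.ofReal (ν ^ 2) * E u)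
    (hreg : ∀ u v : H, E u ≠ ⊤ → E v ≠ ⊤ → slopeP E u v = slopeM E u v)
    (hsym : ∀ u v : H, E u ≠ ⊤ → E v ≠ ⊤ → slopeP E u v = slopeP E v u) :
    ∀ u v : H, E u ≠ ⊤ → E v ≠ ⊤ →
      E (u + v) + E (u - v) = 2 * E u + 2 * E v := by
  intro u v hu hv
  have hdom := fun {u v : H} (hu : E u ≠ ⊤) (hv : E v ≠ ⊤) => ne_top_add_smul hconv hhom hu hv
  have hder : ∀ {u v : H}, E u ≠ ⊤ → E v ≠ ⊤ →
      HasDerivAt (fun σ : ℝ => (E (u + σ • v)).toReal) (slopeP E u v) 0 := fun hu hv =>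
    hasDerivAt_slopeP (convexOn_toReal_add_smul hconv hhom hu hv) (hreg _ _ hu hv)
  have hslope (s : ℝ) :
      slopeP E (u + s • v) v = slopeP E v u + 2 * s * (E v).toReal := by
    rw [hsym _ _ (hdom hu hv s) hv]
    exact (hder hv (hdom hu hv s)).unique
      (hasDerivAt_toReal_add_smul_add_smul hhom (hder hv hu) s)
  have hline (s : ℝ) : HasDerivAt (fun σ : ℝ => (E (u + σ • v)).toReal)
      (slopeP E v u + 2 * s * (E v).toReal) s := by
    rw [← hslope s]
    have h := HasDerivAt.comp_sub_const s s (by simpa using hder (hdom hu hv s) hv)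
    refine h.congr_of_eventuallyEq (.of_forall fun σ => ?_)
    have hshift : u + σ • v = u + s • v + (σ - s) • v := by module
    simp only [hshift]
  have hzero (s : ℝ) : HasDerivAt (fun σ : ℝ => (E (u + σ • v)).toReal -
      (σ * slopeP E v u + σ ^ 2 * (E v).toReal)) 0 s := by
    refine ((hline s).fun_sub (((hasDerivAt_id s).mul_const (slopeP E v u)).fun_add
      ((hasDerivAt_pow 2 s).mul_const (E v).toReal))).congr_deriv ?_
    simp
  have hconst := is_const_of_deriv_eq_zero (fun s => (hzero s).differentiableAt)
    fun s => (hzero s).deriv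
  have hpos := hconst 1 0
  have hneg := hconst (-1) 0
  have hadd := hdom hu hv 1
  have hsub := hdom hu hv (-1)
  simp only [one_smul, neg_smul, zero_smul, add_zero, ← sub_eq_add_neg] at hpos hneg hadd hsub
  rw [← ENNReal.toReal_eq_toReal_iff' (by finiteness) (by finiteness),
    ENNReal.toReal_add hadd hsub, ENNReal.toReal_add (by finiteness) (by finiteness),
    ENNReal.toReal_mul, ENNReal.toReal_mul, ENNReal.toReal_ofNat]
  linarith
end

section
/- Let E : H → [0,∞] be convex, lower semicontinuous and 2-homogeneous, and let u, v ∈ D(E). For each λ > 0, let w_λ ∈ H be a minimizer over H of z ↦ E(z) + ‖u − z‖²/(2λ), and set A_λ u = (u − w_λ)/λ (the Yosida regularisation of ∂E applied to u). Then Λ⁻(u,v) ≤ liminf_{λ→0⁺} ⟨A_λ u, v⟩ ≤ limsup_{λ→0⁺} ⟨A_λ u, v⟩ ≤ Λ⁺(u,v). In particular, if Λ⁺(u,v) = Λ⁻(u,v) =: Λ(u,v), then ⟨A_λ u, v⟩ → Λ(u,v) as λ → 0⁺. -/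
open Filter Topology
open scoped ENNReal RealInnerProductSpace

/-- A real number dominated by `a + t * b` for all small `t > 0` is dominated by `a`. -/
lemma le_of_forall_le_add_mul {x a b : ℝ} (h : ∀ t : ℝ, 0 < t → t < 1 → x ≤ a + t * b) :
    x ≤ a := by
  have ht : Tendsto (fun t : ℝ => a + t * b) (𝓝[>] 0) (𝓝 a) := by
    have : Tendsto (fun t : ℝ => a + t * b) (𝓝 0) (𝓝 (a + 0 * b)) :=
      Continuous.tendsto (by fun_prop) 0
    simpa using this.mono_left nhdsWithin_le_nhds
  refine ge_of_tendsto ht ?_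
  filter_upwards [Ioo_mem_nhdsGT (zero_lt_one' ℝ)] with t ht using h t ht.1 ht.2

section Proximal

variable {H : Type*} [NormedAddCommGroup H] {E : H → ℝ≥0∞} {u p : H} {l : ℝ}

/-- A proximal point of `u` has energy at most that of `u`. -/
lemma proximal_energy_le
    (hp : ∀ z : H, E p + ENNReal.ofReal (‖u - p‖ ^ 2 / (2 * l)) ≤
      E z + ENNReal.ofReal (‖u - z‖ ^ 2 / (2 * l))) : E p ≤ E u :=
  le_self_add.trans (by simpa using hp u)

/-- Minimality of a proximal point, as an inequality between real numbers. -/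
lemma proximal_toReal_le (hl : 0 < l) (hu : E u ≠ ⊤)
    (hp : ∀ z : H, E p + ENNReal.ofReal (‖u - p‖ ^ 2 / (2 * l)) ≤
      E z + ENNReal.ofReal (‖u - z‖ ^ 2 / (2 * l))) {z : H} (hz : E z ≠ ⊤) :
    (E p).toReal + ‖u - p‖ ^ 2 / (2 * l) ≤ (E z).toReal + ‖u - z‖ ^ 2 / (2 * l) := by
  have hpt : E p ≠ ⊤ := ne_top_of_le_ne_top hu (proximal_energy_le hp)
  have h := ENNReal.toReal_mono (by finiteness) (hp z)
  rwa [ENNReal.toReal_add hpt ENNReal.ofReal_ne_top, ENNReal.toReal_add hz ENNReal.ofReal_ne_top,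
    ENNReal.toReal_ofReal (by positivity), ENNReal.toReal_ofReal (by positivity)] at h

/-- Proximal points converge to `u` as the parameter tends to `0⁺`. -/
lemma tendsto_proximal {w : ℝ → H} (hu : E u ≠ ⊤)
    (hmin : ∀ l : ℝ, 0 < l → ∀ z : H,
      E (w l) + ENNReal.ofReal (‖u - w l‖ ^ 2 / (2 * l)) ≤
        E z + ENNReal.ofReal (‖u - z‖ ^ 2 / (2 * l))) :
    Tendsto w (𝓝[>] 0) (𝓝 u) := by
  have hsq : Tendsto (fun l : ℝ => √(2 * l * (E u).toReal)) (𝓝[>] 0) (𝓝 0) := by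
    have : Tendsto (fun l : ℝ => √(2 * l * (E u).toReal)) (𝓝 0) (𝓝 √(2 * 0 * (E u).toReal)) :=
      Continuous.tendsto (by fun_prop) 0
    simpa using this.mono_left nhdsWithin_le_nhds
  rw [tendsto_iff_norm_sub_tendsto_zero]
  refine squeeze_zero' (Eventually.of_forall fun _ => norm_nonneg _) ?_ hsq
  filter_upwards [self_mem_nhdsWithin] with l hl
  have hl : 0 < l := hl
  have h := proximal_toReal_le hl hu (hmin l hl) hu
  have h0 : 0 ≤ (E (w l)).toReal := ENNReal.toReal_nonneg
  simp only [sub_self, norm_zero, ne_eq, OfNat.ofNat_ne_zero, not_false_eq_true, zero_pow,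
    zero_div, add_zero] at h
  have h2 : ‖u - w l‖ ^ 2 / (2 * l) ≤ (E u).toReal := by linarith
  rw [div_le_iff₀ (by positivity)] at h2
  rw [norm_sub_rev]
  exact Real.le_sqrt_of_sq_le (by linarith)

/-- The energies of proximal points converge to the energy of `u`. -/
lemma tendsto_proximal_energy {w : ℝ → H} (hlsc : LowerSemicontinuous E) (hu : E u ≠ ⊤)
    (hmin : ∀ l : ℝ, 0 < l → ∀ z : H,
      E (w l) + ENNReal.ofReal (‖u - w l‖ ^ 2 / (2 * l)) ≤
        E z + ENNReal.ofReal (‖u - z‖ ^ 2 / (2 * l))) :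
    Tendsto (fun l => (E (w l)).toReal) (𝓝[>] 0) (𝓝 (E u).toReal) := by
  refine (ENNReal.tendsto_toReal hu).comp (tendsto_order.2 ⟨fun a ha => ?_, fun a ha => ?_⟩)
  · exact (tendsto_proximal hu hmin).eventually (hlsc u a ha)
  · filter_upwards [self_mem_nhdsWithin] with l hl
    exact (proximal_energy_le (hmin l hl)).trans_lt ha

variable [InnerProductSpace ℝ H]

/-- The Yosida regularisation of `∂E` at `u` is a subgradient of `E` at the proximal point. -/
lemma yosida_subgradient
    (hconv : ∀ u v : H, ∀ t : ℝ, t ∈ Set.Icc (0 : ℝ) 1 →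
      E (t • u + (1 - t) • v) ≤ ENNReal.ofReal t * E u + ENNReal.ofReal (1 - t) * E v)
    (hl : 0 < l) (hu : E u ≠ ⊤)
    (hp : ∀ z : H, E p + ENNReal.ofReal (‖u - p‖ ^ 2 / (2 * l)) ≤
      E z + ENNReal.ofReal (‖u - z‖ ^ 2 / (2 * l))) {z : H} (hz : E z ≠ ⊤) :
    (E p).toReal + ⟪l⁻¹ • (u - p), z - p⟫ ≤ (E z).toReal := by
  have hpt : E p ≠ ⊤ := ne_top_of_le_ne_top hu (proximal_energy_le hp)
  refine le_of_forall_le_add_mul (b := ‖z - p‖ ^ 2 / (2 * l)) fun t ht0 ht1 => ?_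
  have hc := hconv z p t ⟨ht0.le, ht1.le⟩
  have hct : E (t • z + (1 - t) • p) ≠ ⊤ := ne_top_of_le_ne_top (by finiteness) hc
  have hc' := ENNReal.toReal_mono (by finiteness) hc
  rw [ENNReal.toReal_add (by finiteness) (by finiteness), ENNReal.toReal_mul, ENNReal.toReal_mul,
    ENNReal.toReal_ofReal ht0.le, ENNReal.toReal_ofReal (by linarith)] at hc'
  have hm := proximal_toReal_le hl hu hp hct
  have hvec : u - (t • z + (1 - t) • p) = (u - p) - t • (z - p) := by module
  rw [hvec, norm_sub_sq_real (u - p), inner_smul_right, norm_smul, Real.norm_of_nonneg ht0.le] at hm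
  rw [real_inner_smul_left]
  have hexp : (‖u - p‖ ^ 2 - 2 * (t * ⟪u - p, z - p⟫) + (t * ‖z - p‖) ^ 2) / (2 * l) =
      ‖u - p‖ ^ 2 / (2 * l) - t * (l⁻¹ * ⟪u - p, z - p⟫) + t * (t * (‖z - p‖ ^ 2 / (2 * l))) := by
    field_simp
  rw [hexp] at hm
  refine le_of_mul_le_mul_left ?_ ht0
  linarith

/-- Difference-quotient bound for the Yosida regularisation in a direction `v`. -/
lemma mul_inner_yosida_le
    (hconv : ∀ u v : H, ∀ t : ℝ, t ∈ Set.Icc (0 : ℝ) 1 →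
      E (t • u + (1 - t) • v) ≤ ENNReal.ofReal t * E u + ENNReal.ofReal (1 - t) * E v)
    (hl : 0 < l) (hu : E u ≠ ⊤)
    (hp : ∀ z : H, E p + ENNReal.ofReal (‖u - p‖ ^ 2 / (2 * l)) ≤
      E z + ENNReal.ofReal (‖u - z‖ ^ 2 / (2 * l))) {v : H} {σ : ℝ} (hz : E (u + σ • v) ≠ ⊤) :
    σ * ⟪l⁻¹ • (u - p), v⟫ ≤ (E (u + σ • v)).toReal - (E p).toReal := by
  have h := yosida_subgradient hconv hl hu hp hz
  have hvec : u + σ • v - p = (u - p) + σ • v := by module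
  rw [hvec, inner_add_right, inner_smul_right, real_inner_smul_left (u - p) (u - p)] at h
  have : 0 ≤ l⁻¹ * ⟪u - p, u - p⟫ := mul_nonneg (by positivity) real_inner_self_nonneg
  linarith

end Proximal

/-- The domain of a convex `2`-homogeneous functional contains the lines through its points in
directions of the domain. -/
lemma energy_add_smul_ne_top {H : Type*} [AddCommGroup H] [Module ℝ H] {E : H → ℝ≥0∞}
    (hconv : ∀ u v : H, ∀ t : ℝ, t ∈ Set.Icc (0 : ℝ) 1 →
      E (t • u + (1 - t) • v) ≤ ENNReal.ofReal t * E u + ENNReal.ofReal (1 - t) * E v)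
    (hhom : ∀ (ν : ℝ) (u : H), E (ν • u) = ENNReal.ofReal (ν ^ 2) * E u)
    {u v : H} (hu : E u ≠ ⊤) (hv : E v ≠ ⊤) (σ : ℝ) : E (u + σ • v) ≠ ⊤ := by
  have h := hconv ((2 : ℝ) • u) ((2 * σ) • v) (1 / 2) (by norm_num)
  have hvec : (1 / 2 : ℝ) • (2 : ℝ) • u + (1 - 1 / 2 : ℝ) • (2 * σ) • v = u + σ • v := by module
  rw [hvec, hhom, hhom] at h
  exact ne_top_of_le_ne_top (by finiteness) h

/-- let `E` be convex, lower semicontinuous and `2`-homogeneous, and let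
`u, v ∈ D(E)`. For `λ > 0`, let `w λ` minimise `z ↦ E(z) + ‖u − z‖²/(2λ)` over `H` and
set `A_λ u = (u − w λ)/λ` (the Yosida regularisation of `∂E` applied to `u`). Then
`Λ⁻(u,v) ≤ liminf_{λ→0⁺} ⟪A_λ u, v⟫ ≤ limsup_{λ→0⁺} ⟪A_λ u, v⟫ ≤ Λ⁺(u,v)`; in
particular, if `Λ⁺(u,v) = Λ⁻(u,v) =: Λ(u,v)` then `⟪A_λ u, v⟫ → Λ(u,v)` as `λ → 0⁺`. -/
theorem stmt19 {H : Type*} [NormedAddCommGroup H] [InnerProductSpace ℝ H] [CompleteSpace H]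
    (E : H → ℝ≥0∞)
    (hconv : ∀ u v : H, ∀ t : ℝ, t ∈ Set.Icc (0 : ℝ) 1 →
      E (t • u + (1 - t) • v) ≤ ENNReal.ofReal t * E u + ENNReal.ofReal (1 - t) * E v)
    (hlsc : LowerSemicontinuous E)
    (hhom : ∀ (ν : ℝ) (u : H), E (ν • u) = ENNReal.ofReal (ν ^ 2) * E u)
    (u v : H) (hu : E u ≠ ⊤) (hv : E v ≠ ⊤)
    (w : ℝ → H)
    (hmin : ∀ l : ℝ, 0 < l → ∀ z : H,
      E (w l) + ENNReal.ofReal (‖u - w l‖ ^ 2 / (2 * l)) ≤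
        E z + ENNReal.ofReal (‖u - z‖ ^ 2 / (2 * l))) :
    slopeM E u v ≤ liminf (fun l : ℝ => ⟪l⁻¹ • (u - w l), v⟫) (𝓝[>] (0 : ℝ)) ∧
    liminf (fun l : ℝ => ⟪l⁻¹ • (u - w l), v⟫) (𝓝[>] (0 : ℝ)) ≤
      limsup (fun l : ℝ => ⟪l⁻¹ • (u - w l), v⟫) (𝓝[>] (0 : ℝ)) ∧
    limsup (fun l : ℝ => ⟪l⁻¹ • (u - w l), v⟫) (𝓝[>] (0 : ℝ)) ≤ slopeP E u v ∧
    (slopeP E u v = slopeM E u v →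
      Tendsto (fun l : ℝ => ⟪l⁻¹ • (u - w l), v⟫) (𝓝[>] (0 : ℝ))
        (𝓝 (slopeP E u v))) := by
  have hdom := energy_add_smul_ne_top hconv hhom hu hv
  have hE := tendsto_proximal_energy hlsc hu hmin
  have hbd (σ : ℝ) : ∀ᶠ l in 𝓝[>] (0 : ℝ), σ * ⟪l⁻¹ • (u - w l), v⟫ ≤
      (E (u + σ • v)).toReal - (E (w l)).toReal := by
    filter_upwards [self_mem_nhdsWithin] with l hl
    exact mul_inner_yosida_le hconv hl hu (hmin l hl) (hdom σ)
  have hlim (σ : ℝ) : Tendsto (fun l => ((E (u + σ • v)).toReal - (E (w l)).toReal) / σ)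
      (𝓝[>] 0) (𝓝 (((E (u + σ • v)).toReal - (E u).toReal) / σ)) :=
    (tendsto_const_nhds.sub hE).div_const σ
  have hupper {σ : ℝ} (hσ : 0 < σ) : ∀ᶠ l in 𝓝[>] (0 : ℝ), ⟪l⁻¹ • (u - w l), v⟫ ≤
      ((E (u + σ • v)).toReal - (E (w l)).toReal) / σ := by
    filter_upwards [hbd σ] with l hl
    rw [le_div_iff₀ hσ]
    linarith
  have hlower {σ : ℝ} (hσ : σ < 0) : ∀ᶠ l in 𝓝[>] (0 : ℝ),
      ((E (u + σ • v)).toReal - (E (w l)).toReal) / σ ≤ ⟪l⁻¹ • (u - w l), v⟫ := by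
    filter_upwards [hbd σ] with l hl
    rw [div_le_iff_of_neg hσ]
    linarith
  have hab : IsBoundedUnder (· ≤ ·) (𝓝[>] (0 : ℝ)) fun l => ⟪l⁻¹ • (u - w l), v⟫ :=
    (hlim 1).isBoundedUnder_le.mono_le (hupper one_pos)
  have hbe : IsBoundedUnder (· ≥ ·) (𝓝[>] (0 : ℝ)) fun l => ⟪l⁻¹ • (u - w l), v⟫ :=
    (hlim (-1)).isBoundedUnder_ge.mono_ge (hlower (by norm_num))
  have hM : slopeM E u v ≤ liminf (fun l : ℝ => ⟪l⁻¹ • (u - w l), v⟫) (𝓝[>] (0 : ℝ)) := by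
    refine csSup_le ⟨_, -1, by norm_num, rfl⟩ ?_
    rintro _ ⟨σ, hσ, rfl⟩
    rw [← (hlim σ).liminf_eq]
    exact liminf_le_liminf (hlower hσ) (hlim σ).isBoundedUnder_ge hab.isCoboundedUnder_ge
  have hP : limsup (fun l : ℝ => ⟪l⁻¹ • (u - w l), v⟫) (𝓝[>] (0 : ℝ)) ≤ slopeP E u v := by
    refine le_csInf ⟨_, 1, one_pos, rfl⟩ ?_
    rintro _ ⟨σ, hσ, rfl⟩
    rw [← (hlim σ).limsup_eq]
    exact limsup_le_limsup (hupper hσ) hbe.isCoboundedUnder_le (hlim σ).isBoundedUnder_le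
  exact ⟨hM, liminf_le_limsup hab hbe, hP, fun h =>
    tendsto_of_le_liminf_of_limsup_le (h ▸ hM) hP hab hbe⟩
end
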